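/- The first-order theory of the structure (ℝ; exp, ln, 0, 1, <), where exp(x) = e^x and ln is the natural logarithm extended by setting ln(x) = 0 for all x ≤ 0, admits elimination of quantifiers: every formula is equivalent over this structure to a quantifier-free formula in the same free variables. Consequently this theory is decidable. -/

import Mathlib

namespace Paper

open FirstOrder Language

section Encoding

variable {L : Language} [∀ n, Encodable (L.Functions n)] [∀ n, Encodable (L.Relations n)]

/-- A canonical encoding of sentences, derived from Mathlib's list encoding of
bounded formulas. -/
instance sentenceEncodable : Encodable L.Sentence :=
  Encodable.ofLeftInjection
    (fun φ => BoundedFormula.listEncode φ)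
    (fun l => (BoundedFormula.listDecode l)[0]?.bind
      (fun ψ => if h : ψ.1 = 0 then some (cast (by rw [h]) ψ.2) else none))
    (fun φ => by
      have h := BoundedFormula.listDecode_encode_list (L := L) (α := Empty) [⟨0, φ⟩]
      simp only [List.flatMap_singleton] at h
      simp [h])

end Encoding

/-- A sentence is universal if it is of the form `∀ x₁ … ∀ xₙ ψ` with `ψ` quantifier-free. -/
def IsUniversalSentence {L : Language} (φ : L.Sentence) : Prop :=
  ∃ (n : ℕ) (ψ : L.BoundedFormula Empty n), ψ.IsQF ∧ φ = ψ.alls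

/-- The universal fragment of a theory: the set of universal sentences it proves
(equivalently, by the Gödel completeness theorem, its universal semantic consequences). -/
def univFragment {L : Language} (T : L.Theory) : Set L.Sentence :=
  {φ | IsUniversalSentence φ ∧ T ⊨ᵇ φ}

/-- A set of objects with a canonical encoding is decidable if some computable function
decides membership via codes. -/
def DecidableVia {α : Type} [Encodable α] (S : Set α) : Prop :=
  ∃ f : ℕ → Bool, Computable f ∧ ∀ a : α, a ∈ S ↔ f (Encodable.encode a) = true

end Paper
namespace Paper

open FirstOrder Language

/-- The language with constants `0, 1`, unary functions `exp, ln`, and the relation `<`.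
Unary functions are indexed by `Fin 2` (`0 ↦ exp`, `1 ↦ ln`). -/
@[reducible] def expLang : Language where
  Functions
    | 0 => Fin 2
    | 1 => Fin 2
    | _ + 2 => Empty
  Relations
    | 2 => Unit
    | _ => Empty

/-- The intended interpretation in `ℝ`: `exp x = e^x`, and `ln` is the natural logarithm,
extended by `ln x = 0` for `x ≤ 0`. -/
noncomputable instance expStructure : expLang.Structure ℝ where
  funMap {n} f x :=
    match n, f, x with
    | 0, i, _ => if i = 0 then (0 : ℝ) else 1
    | 1, i, x => if i = 0 then Real.exp (x 0) else if x 0 ≤ 0 then 0 else Real.log (x 0)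
    | _ + 2, f, _ => f.elim
  RelMap {n} r x :=
    match n, r, x with
    | 0, r, _ => r.elim
    | 1, r, _ => r.elim
    | 2, _, x => x 0 < x 1
    | _ + 3, r, _ => r.elim

instance expFunctionsEncodable : ∀ n, Encodable (expLang.Functions n)
  | 0 => inferInstanceAs (Encodable (Fin 2))
  | 1 => inferInstanceAs (Encodable (Fin 2))
  | _ + 2 => inferInstanceAs (Encodable Empty)

instance expRelationsEncodable : ∀ n, Encodable (expLang.Relations n)
  | 0 => inferInstanceAs (Encodable Empty)
  | 1 => inferInstanceAs (Encodable Empty)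
  | 2 => inferInstanceAs (Encodable Unit)
  | _ + 3 => inferInstanceAs (Encodable Empty)

/-! ### Semantic part -/

/-- The iterated exponential. -/
noncomputable def itE (k : ℕ) (x : ℝ) : ℝ := Real.exp^[k] x

theorem itE_zero (x : ℝ) : itE 0 x = x := rfl

theorem itE_succ (k : ℕ) (x : ℝ) : itE (k + 1) x = Real.exp (itE k x) :=
  Function.iterate_succ_apply' _ _ _

theorem itE_succ' (k : ℕ) (x : ℝ) : itE (k + 1) x = itE k (Real.exp x) :=
  Function.iterate_succ_apply _ _ _

theorem itE_add (k l : ℕ) (x : ℝ) : itE (k + l) x = itE k (itE l x) :=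
  Function.iterate_add_apply _ _ _ _

theorem itE_strictMono (k : ℕ) : StrictMono (itE k) := Real.exp_strictMono.iterate k

theorem itE_lt_iff (k : ℕ) {x y : ℝ} : itE k x < itE k y ↔ x < y :=
  (itE_strictMono k).lt_iff_lt

theorem itE_le_iff (k : ℕ) {x y : ℝ} : itE k x ≤ itE k y ↔ x ≤ y :=
  (itE_strictMono k).le_iff_le

theorem lt_exp_self (x : ℝ) : x < Real.exp x := by
  have := Real.add_one_le_exp x
  linarith

theorem itE_index_strictMono (x : ℝ) : StrictMono (fun k => itE k x) :=
  strictMono_nat_of_lt_succ fun n => by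
    rw [itE_succ]
    exact lt_exp_self _

theorem itE_index_lt_iff (x : ℝ) {k l : ℕ} : itE k x < itE l x ↔ k < l :=
  (itE_index_strictMono x).lt_iff_lt

theorem itE_surj (M : ℕ) : ∀ r : ℝ, itE M 0 < r → ∃ b, itE (M + 1) b = r := by
  induction M with
  | zero =>
    intro r hr
    exact ⟨Real.log r, by rw [itE_succ, itE_zero, Real.exp_log hr]⟩
  | succ M ih =>
    intro r hr
    rw [itE_succ] at hr
    have hr0 : 0 < r := (Real.exp_pos _).trans hr
    obtain ⟨b, hb⟩ := ih (Real.log r) ((Real.lt_log_iff_exp_lt hr0).2 hr)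
    exact ⟨b, by rw [itE_succ, hb, Real.exp_log hr0]⟩

/-- Two families of reals satisfy the same comparisons of iterated exponentials up to `L`. -/
def SameCmp {ι : Type*} (L : ℕ) (f g : ι → ℝ) : Prop :=
  ∀ i j, ∀ k ≤ L, ∀ l ≤ L, (itE k (f i) < itE l (f j) ↔ itE k (g i) < itE l (g j))

theorem SameCmp.symm {ι : Type*} {L : ℕ} {f g : ι → ℝ} (h : SameCmp L f g) : SameCmp L g f :=
  fun i j k hk l hl => (h i j k hk l hl).symm

theorem SameCmp.mono {ι : Type*} {L L' : ℕ} {f g : ι → ℝ} (h : SameCmp L f g) (hL : L' ≤ L) :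
    SameCmp L' f g :=
  fun i j k hk l hl => h i j k (hk.trans hL) l (hl.trans hL)

theorem SameCmp.le_iff {ι : Type*} {L : ℕ} {f g : ι → ℝ} (h : SameCmp L f g) (i j : ι)
    {k l : ℕ} (hk : k ≤ L) (hl : l ≤ L) :
    itE k (f i) ≤ itE l (f j) ↔ itE k (g i) ≤ itE l (g j) := by
  rw [← not_lt, ← not_lt, h j i l hl k hk]

theorem SameCmp.eq_iff {ι : Type*} {L : ℕ} {f g : ι → ℝ} (h : SameCmp L f g) (i j : ι)
    {k l : ℕ} (hk : k ≤ L) (hl : l ≤ L) :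
    itE k (f i) = itE l (f j) ↔ itE k (g i) = itE l (g j) := by
  rw [le_antisymm_iff, le_antisymm_iff, h.le_iff i j hk hl, h.le_iff j i hl hk]

theorem sameCmp_extend {ι κ : Type*} {L : ℕ} {f g : ι → ℝ} (h : SameCmp L f g) {a b : ℝ}
    (hlt : ∀ i, ∀ k ≤ 2 * L, (itE k (f i) < itE L a ↔ itE k (g i) < itE L b))
    (hgt : ∀ i, ∀ k ≤ 2 * L, (itE L a < itE k (f i) ↔ itE L b < itE k (g i)))
    {f' g' : κ → ℝ}
    (hcov : ∀ j, (∃ i, f' j = f i ∧ g' j = g i) ∨ (f' j = a ∧ g' j = b)) :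
    SameCmp L f' g' := by
  have key : ∀ (x y : ℝ) (k l : ℕ), k ≤ L →
      (itE k x < itE l y ↔ itE L x < itE (L - k + l) y) := by
    intro x y k l hk
    rw [← itE_lt_iff (L - k), ← itE_add, ← itE_add, Nat.sub_add_cancel hk]
  have key' : ∀ (x y : ℝ) (k l : ℕ), l ≤ L →
      (itE k x < itE l y ↔ itE (L - l + k) x < itE L y) := by
    intro x y k l hk
    rw [← itE_lt_iff (L - l), ← itE_add, ← itE_add, Nat.sub_add_cancel hk]
  intro i j k hk l hl
  rcases hcov i with ⟨i', h1, h2⟩ | ⟨h1, h2⟩ <;> rcases hcov j with ⟨j', h3, h4⟩ | ⟨h3, h4⟩ <;>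
    rw [h1, h2, h3, h4]
  · exact h i' j' k hk l hl
  · rw [key' _ _ _ _ hl, key' _ _ _ _ hl]
    exact hlt _ _ (by omega)
  · rw [key _ _ _ _ hk, key _ _ _ _ hk]
    exact hgt _ _ (by omega)
  · rw [itE_index_lt_iff, itE_index_lt_iff]

theorem exists_cut {ι : Type*} [Finite ι] {M : ℕ} {f g : ι → ℝ} (o : ι) (hf : f o = 0)
    (hg : g o = 0) (h : SameCmp (2 * (M + 1)) f g) (a : ℝ) (C : Set ℝ)
    (hC1 : ∀ i, ∀ k ≤ 2 * (M + 1), itE k (g i) ∈ C)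
    (hC2 : ∀ i, ∀ k ≤ 2 * (M + 1), Real.exp (itE k (g i)) ∈ C)
    (hC3 : ∀ i j, ∀ k ≤ 2 * (M + 1), ∀ l ≤ 2 * (M + 1), itE k (g i) < itE l (g j) →
      ∃ r ∈ C, itE k (g i) < r ∧ r < itE l (g j)) :
    ∃ b, itE (M + 1) b ∈ C ∧
      (∀ i, ∀ k ≤ 2 * (M + 1), (itE k (f i) < itE (M + 1) a ↔ itE k (g i) < itE (M + 1) b)) ∧
      (∀ i, ∀ k ≤ 2 * (M + 1), (itE (M + 1) a < itE k (f i) ↔ itE (M + 1) b < itE k (g i))) := by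
  classical
  have := Fintype.ofFinite ι
  set P : ℕ := 2 * (M + 1) with hP
  have hMP : M ≤ P := by omega
  have hoa : itE M (f o) < itE (M + 1) a := by
    rw [hf, itE_succ', itE_lt_iff]
    exact Real.exp_pos a
  suffices hs : ∃ r ∈ C, itE M (g o) < r ∧
      (∀ i, ∀ k ≤ P, (itE k (f i) < itE (M + 1) a ↔ itE k (g i) < r)) ∧
      (∀ i, ∀ k ≤ P, (itE (M + 1) a < itE k (f i) ↔ r < itE k (g i))) by
    obtain ⟨r, hrC, hr, h1, h2⟩ := hs
    rw [hg] at hr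
    obtain ⟨b, hb⟩ := itE_surj M r hr
    exact ⟨b, by rwa [hb], by rwa [hb], by rwa [hb]⟩
  by_cases heq : ∃ i, ∃ k ≤ P, itE k (f i) = itE (M + 1) a
  · obtain ⟨i, k, hk, hik⟩ := heq
    refine ⟨itE k (g i), hC1 i k hk, ?_, ?_, ?_⟩
    · rw [← hik] at hoa
      exact (h _ _ _ hMP _ hk).1 hoa
    · intro j l hl
      rw [← hik]
      exact h _ _ _ hl _ hk
    · intro j l hl
      rw [← hik]
      exact h _ _ _ hk _ hl
  push Not at heq
  let lo : Finset (ι × Fin (P + 1)) :=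
    Finset.univ.filter fun p => itE p.2 (f p.1) < itE (M + 1) a
  let up : Finset (ι × Fin (P + 1)) :=
    Finset.univ.filter fun p => itE (M + 1) a < itE p.2 (f p.1)
  have hlo : lo.Nonempty := ⟨(o, ⟨M, by omega⟩), by simpa [lo] using hoa⟩
  obtain ⟨p, hp, hpmax⟩ := Finset.exists_max_image lo (fun p => itE p.2 (f p.1)) hlo
  have hp' : itE p.2 (f p.1) < itE (M + 1) a := by simpa [lo] using hp
  have hp2 : (p.2 : ℕ) ≤ P := by have := p.2.2; omega
  have hlow : ∀ i, ∀ k ≤ P, itE k (f i) < itE (M + 1) a → itE k (g i) ≤ itE p.2 (g p.1) := by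
    intro i k hk hik
    have := hpmax (i, ⟨k, by omega⟩) (by simpa [lo] using hik)
    exact (h.le_iff _ _ hk hp2).1 this
  by_cases hup : up.Nonempty
  · obtain ⟨q, hq, hqmin⟩ := Finset.exists_min_image up (fun p => itE p.2 (f p.1)) hup
    have hq' : itE (M + 1) a < itE q.2 (f q.1) := by simpa [up] using hq
    have hq2 : (q.2 : ℕ) ≤ P := by have := q.2.2; omega
    have hupp : ∀ i, ∀ k ≤ P, itE (M + 1) a < itE k (f i) → itE q.2 (g q.1) ≤ itE k (g i) := by
      intro i k hk hik
      have := hqmin (i, ⟨k, by omega⟩) (by simpa [up] using hik)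
      exact (h.le_iff _ _ hq2 hk).1 this
    obtain ⟨r, hrC, hr1, hr2⟩ := hC3 p.1 q.1 p.2 hp2 q.2 hq2
      ((h _ _ _ hp2 _ hq2).1 (hp'.trans hq'))
    refine ⟨r, hrC, (hlow _ _ hMP hoa).trans_lt hr1, ?_, ?_⟩
    · intro i k hk
      refine ⟨fun hh => (hlow i k hk hh).trans_lt hr1, fun hh => ?_⟩
      by_contra hcon
      have h3 := lt_of_le_of_ne (not_lt.1 hcon) (heq i k hk).symm
      exact absurd (hupp i k hk h3) (not_le.2 (hh.trans hr2))
    · intro i k hk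
      refine ⟨fun hh => hr2.trans_le (hupp i k hk hh), fun hh => ?_⟩
      by_contra hcon
      have h3 := lt_of_le_of_ne (not_lt.1 hcon) (heq i k hk)
      exact absurd (hlow i k hk h3) (not_le.2 (hr1.trans hh))
  · have hall : ∀ i, ∀ k ≤ P, itE k (f i) < itE (M + 1) a := by
      intro i k hk
      by_contra hcon
      have h3 := lt_of_le_of_ne (not_lt.1 hcon) (heq i k hk).symm
      exact hup ⟨(i, ⟨k, by omega⟩), by simpa [up] using h3⟩
    have hr1 := lt_exp_self (itE p.2 (g p.1))
    refine ⟨_, hC2 p.1 p.2 hp2, (hlow _ _ hMP hoa).trans_lt hr1, ?_, ?_⟩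
    · intro i k hk
      exact ⟨fun hh => (hlow i k hk hh).trans_lt hr1, fun _ => hall i k hk⟩
    · intro i k hk
      have h1 := hall i k hk
      exact ⟨fun hh => absurd h1 hh.not_gt,
        fun hh => absurd ((hlow i k hk h1).trans_lt hr1) hh.not_gt⟩

/-- Logarithm with value zero at non-positive arguments. -/
noncomputable def lnz (x : ℝ) : ℝ := if x ≤ 0 then 0 else Real.log x

/-- Depth (number of function symbols) of a term. -/
def tdepth {β : Type*} : expLang.Term β → ℕ
  | .var _ => 0
  | .func _ ts => 1 + ∑ i, tdepth (ts i)

theorem realize_c {β : Type*} (c : Fin 2) (ts : Fin 0 → expLang.Term β) (v : β → ℝ) :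
    (Term.func (L := expLang) (l := 0) c ts).realize v = if c = 0 then (0 : ℝ) else 1 := rfl

theorem realize_u {β : Type*} (c : Fin 2) (ts : Fin 1 → expLang.Term β) (v : β → ℝ) :
    (Term.func (L := expLang) (l := 1) c ts).realize v =
      if c = 0 then Real.exp ((ts 0).realize v) else lnz ((ts 0).realize v) := rfl

theorem tdepth_c {β : Type*} (c : Fin 2) (ts : Fin 0 → expLang.Term β) :
    tdepth (Term.func (L := expLang) (l := 0) c ts) = 1 := rfl

theorem tdepth_u {β : Type*} (c : Fin 2) (ts : Fin 1 → expLang.Term β) :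
    tdepth (Term.func (L := expLang) (l := 1) c ts) = 1 + tdepth (ts 0) := by
  simp [tdepth]

/-- Induction for terms of the language. -/
theorem term_ind {β : Type*} {P : expLang.Term β → Prop} (hv : ∀ i, P (.var i))
    (hc : ∀ (c : Fin 2) (ts : Fin 0 → expLang.Term β), P (Term.func (L := expLang) (l := 0) c ts))
    (hu : ∀ (c : Fin 2) (ts : Fin 1 → expLang.Term β), P (ts 0) →
      P (Term.func (L := expLang) (l := 1) c ts)) (t : expLang.Term β) : P t := by
  induction t with
  | var i => exact hv i
  | @func l c ts ih =>
    match l, c, ts, ih with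
    | 0, c, ts, _ => exact hc c ts
    | 1, c, ts, ih => exact hu c ts (ih 0)
    | _ + 2, c, _, _ => exact c.elim

theorem term_norm {β : Type*} {N : ℕ} {f g : Option β → ℝ} (hf : f none = 0) (hg : g none = 0)
    (h : SameCmp (2 * N) f g) (t : expLang.Term β) : tdepth t ≤ N →
    ∃ i k, N ≤ k + tdepth t ∧ k ≤ N + tdepth t ∧
      itE N (t.realize fun b => f (some b)) = itE k (f i) ∧
      itE N (t.realize fun b => g (some b)) = itE k (g i) := by
  induction t using term_ind with
  | hv i => exact fun _ => ⟨some i, N, by simp [tdepth]⟩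
  | hc c ts =>
    intro hd
    rw [tdepth_c] at *
    by_cases hc : c = 0
    · refine ⟨none, N, by omega, by omega, ?_, ?_⟩ <;> rw [realize_c, if_pos hc] <;> simp [*]
    · refine ⟨none, N + 1, by omega, by omega, ?_, ?_⟩ <;>
        rw [realize_c, if_neg hc, itE_succ'] <;> simp [*]
  | hu c ts ih =>
    intro hd
    rw [tdepth_u] at *
    obtain ⟨i, k, hk1, hk2, h1, h2⟩ := ih (by omega)
    by_cases hc : c = 0
    · refine ⟨i, k + 1, by omega, by omega, ?_, ?_⟩ <;>
        rw [realize_u, if_pos hc, ← itE_succ', itE_succ, itE_succ]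
      · rw [h1]
      · rw [h2]
    · rw [realize_u, if_neg hc, realize_u, if_neg hc]
      have hiff : ((ts 0).realize fun b => f (some b)) ≤ 0 ↔
          ((ts 0).realize fun b => g (some b)) ≤ 0 := by
        rw [← itE_le_iff N, h1, ← itE_le_iff N (y := 0), h2]
        conv_lhs => rw [← hf]
        conv_rhs => rw [← hg]
        exact h.le_iff _ _ (by omega) (by omega)
      unfold lnz
      by_cases hle : ((ts 0).realize fun b => f (some b)) ≤ 0
      · rw [if_pos hle, if_pos (hiff.1 hle)]
        exact ⟨none, N, by omega, by omega, by rw [hf], by rw [hg]⟩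
      · have hle' := fun h => hle (hiff.2 h)
        rw [if_neg hle, if_neg hle']
        obtain ⟨N', rfl⟩ : ∃ N', N = N' + 1 := ⟨N - 1, by omega⟩
        obtain ⟨k', rfl⟩ : ∃ k', k = k' + 1 := ⟨k - 1, by omega⟩
        refine ⟨i, k', by omega, by omega, ?_, ?_⟩
        · rw [itE_succ', Real.exp_log (not_le.1 hle)]
          rw [itE_succ, itE_succ] at h1
          exact Real.exp_injective h1
        · rw [itE_succ', Real.exp_log (not_le.1 hle')]
          rw [itE_succ, itE_succ] at h2
          exact Real.exp_injective h2

/-- The family of all variable values, together with zero. -/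
def fam {α : Type*} {n : ℕ} (v : α → ℝ) (xs : Fin n → ℝ) : Option (α ⊕ Fin n) → ℝ :=
  fun o => o.elim 0 (Sum.elim v xs)

/-- The number of iterated exponentials that suffices to determine a formula. -/
def lev {α : Type*} : ∀ {n : ℕ}, expLang.BoundedFormula α n → ℕ
  | _, .falsum => 0
  | _, .equal t₁ t₂ => 2 * (tdepth t₁ + tdepth t₂)
  | _, .rel _ ts => 2 * ∑ i, tdepth (ts i)
  | _, .imp φ ψ => lev φ + lev ψ
  | _, .all φ => 2 * (lev φ + 1)

theorem realize_lt {β : Type*} {n : ℕ} (r : Unit) (ts : Fin 2 → expLang.Term (β ⊕ Fin n))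
    (v : β → ℝ) (xs : Fin n → ℝ) :
    (BoundedFormula.rel (L := expLang) (l := 2) r ts).Realize v xs ↔
      (ts 0).realize (Sum.elim v xs) < (ts 1).realize (Sum.elim v xs) := Iff.rfl

theorem sameCmp_snoc {α : Type*} {n L : ℕ} {v w : α → ℝ} {xs ys : Fin n → ℝ}
    (h : SameCmp L (fam v xs) (fam w ys)) {a b : ℝ}
    (hlt : ∀ i, ∀ k ≤ 2 * L, (itE k (fam v xs i) < itE L a ↔ itE k (fam w ys i) < itE L b))
    (hgt : ∀ i, ∀ k ≤ 2 * L, (itE L a < itE k (fam v xs i) ↔ itE L b < itE k (fam w ys i))) :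
    SameCmp L (fam v (Fin.snoc xs a)) (fam w (Fin.snoc ys b)) := by
  refine sameCmp_extend h hlt hgt ?_
  rintro (_ | i | i)
  · exact .inl ⟨none, rfl, rfl⟩
  · exact .inl ⟨some (.inl i), rfl, rfl⟩
  · induction i using Fin.lastCases with
    | last => right; simp [fam]
    | cast i => left; exact ⟨some (.inr i), by simp [fam]⟩

theorem sameCmp_forth {α : Type*} [Finite α] {n L : ℕ} {v w : α → ℝ} {xs ys : Fin n → ℝ}
    (h : SameCmp (2 * (L + 1)) (fam v xs) (fam w ys)) (a : ℝ) :
    ∃ b, SameCmp L (fam v (Fin.snoc xs a)) (fam w (Fin.snoc ys b)) := by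
  obtain ⟨b, -, h1, h2⟩ := exists_cut none rfl rfl h a Set.univ (by simp) (by simp)
    (fun i j k _ l _ hlt => by
      obtain ⟨r, hr⟩ := exists_between hlt
      exact ⟨r, trivial, hr⟩)
  exact ⟨b, (sameCmp_snoc (h.mono (by omega)) h1 h2).mono (by omega)⟩

theorem realize_congr_atom {β : Type*} {N : ℕ} {f g : Option β → ℝ} (hf : f none = 0)
    (hg : g none = 0) (h : SameCmp (2 * N) f g) (t₁ t₂ : expLang.Term β)
    (hN : tdepth t₁ + tdepth t₂ ≤ N) :
    ((t₁.realize fun b => f (some b)) < (t₂.realize fun b => f (some b)) ↔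
      (t₁.realize fun b => g (some b)) < (t₂.realize fun b => g (some b))) ∧
    ((t₁.realize fun b => f (some b)) = (t₂.realize fun b => f (some b)) ↔
      (t₁.realize fun b => g (some b)) = (t₂.realize fun b => g (some b))) := by
  obtain ⟨i, k, _, _, h1, h2⟩ := term_norm hf hg h t₁ (by omega)
  obtain ⟨j, l, _, _, h3, h4⟩ := term_norm hf hg h t₂ (by omega)
  constructor
  · rw [← itE_lt_iff N, h1, h3, ← itE_lt_iff N (y := t₂.realize fun b => g (some b)), h2, h4]
    exact h _ _ _ (by omega) _ (by omega)
  · rw [← (itE_strictMono N).injective.eq_iff, h1, h3,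
      ← (itE_strictMono N).injective.eq_iff (b := t₂.realize fun b => g (some b)), h2, h4]
    exact h.eq_iff _ _ (by omega) (by omega)

theorem realize_congr {α : Type*} [Finite α] {n : ℕ} (φ : expLang.BoundedFormula α n) :
    ∀ {v w : α → ℝ} {xs ys : Fin n → ℝ}, SameCmp (lev φ) (fam v xs) (fam w ys) →
      (φ.Realize v xs ↔ φ.Realize w ys) := by
  induction φ with
  | falsum => intros; rfl
  | equal t₁ t₂ =>
    intro v w xs ys h
    exact (realize_congr_atom (f := fam v xs) (g := fam w ys) rfl rfl h t₁ t₂ le_rfl).2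
  | @rel n l r ts =>
    intro v w xs ys h
    match l, r, ts, h with
    | 0, r, _, _ => exact r.elim
    | 1, r, _, _ => exact r.elim
    | 2, r, ts, h =>
      rw [realize_lt, realize_lt]
      refine (realize_congr_atom (f := fam v xs) (g := fam w ys) rfl rfl h (ts 0) (ts 1) ?_).1
      rw [Fin.sum_univ_two]
    | _ + 3, r, _, _ => exact r.elim
  | imp φ ψ ih1 ih2 =>
    intro v w xs ys h
    rw [BoundedFormula.realize_imp, BoundedFormula.realize_imp,
      ih1 (h.mono (Nat.le_add_right _ _)), ih2 (h.mono (Nat.le_add_left _ _))]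
  | all φ ih =>
    intro v w xs ys h
    rw [BoundedFormula.realize_all, BoundedFormula.realize_all]
    constructor
    · intro H b
      obtain ⟨a, ha⟩ := sameCmp_forth h.symm b
      exact (ih ha).2 (H a)
    · intro H a
      obtain ⟨b, hb⟩ := sameCmp_forth h a
      exact (ih hb).2 (H b)

/-! ### Quantifier elimination -/

/-- Quantifier-free definability of a predicate on assignments. -/
def QFDef {α : Type*} (P : (α → ℝ) → Prop) : Prop :=
  ∃ ψ : expLang.Formula α, ψ.IsQF ∧ ∀ v, P v ↔ ψ.Realize v

theorem QFDef.imp {α : Type*} {P Q : (α → ℝ) → Prop} (hP : QFDef P) (hQ : QFDef Q) :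
    QFDef fun v => P v → Q v := by
  obtain ⟨p, hp, hp'⟩ := hP
  obtain ⟨q, hq, hq'⟩ := hQ
  exact ⟨_, BoundedFormula.IsQF.imp hp hq, fun v => by
    refine (imp_congr (hp' v) (hq' v)).trans ?_
    exact Formula.realize_imp.symm⟩

theorem qfDef_false {α : Type*} : QFDef fun _ : α → ℝ => False :=
  ⟨⊥, BoundedFormula.isQF_bot, fun _ => Iff.rfl⟩

theorem QFDef.congr {α : Type*} {P Q : (α → ℝ) → Prop} (hP : QFDef P) (h : ∀ v, Q v ↔ P v) :
    QFDef Q := by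
  obtain ⟨p, hp, hp'⟩ := hP
  exact ⟨p, hp, fun v => (h v).trans (hp' v)⟩

theorem QFDef.not {α : Type*} {P : (α → ℝ) → Prop} (hP : QFDef P) : QFDef fun v => ¬ P v :=
  hP.imp qfDef_false

theorem qfDef_const {α : Type*} (p : Prop) : QFDef fun _ : α → ℝ => p := by
  by_cases hp : p
  · exact qfDef_false.not.congr fun _ => by simp [hp]
  · exact qfDef_false.congr fun _ => by simp [hp]

theorem QFDef.and {α : Type*} {P Q : (α → ℝ) → Prop} (hP : QFDef P) (hQ : QFDef Q) :
    QFDef fun v => P v ∧ Q v :=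
  (hP.imp hQ.not).not.congr fun _ => by tauto

theorem QFDef.forall_finite {α ι : Type*} [Finite ι] {P : ι → (α → ℝ) → Prop}
    (hP : ∀ i, QFDef (P i)) : QFDef fun v => ∀ i, P i v := by
  classical
  have := Fintype.ofFinite ι
  suffices h : ∀ s : Finset ι, QFDef fun v => ∀ i ∈ s, P i v from
    (h Finset.univ).congr fun v => by simp
  intro s
  induction s using Finset.induction_on with
  | empty => exact (qfDef_const True).congr fun v => by simp
  | insert a s _ ih => exact ((hP a).and ih).congr fun v => by simp

theorem QFDef.exists_finite {α ι : Type*} [Finite ι] {P : ι → (α → ℝ) → Prop}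
    (hP : ∀ i, QFDef (P i)) : QFDef fun v => ∃ i, P i v :=
  (QFDef.forall_finite fun i => (hP i).not).not.congr fun v => by simp

/-- Iterated exponential of a term. -/
def expTerm {β : Type*} (t : expLang.Term β) : ℕ → expLang.Term β
  | 0 => t
  | k + 1 => Term.func (L := expLang) (l := 1) (0 : Fin 2) fun _ => expTerm t k

theorem realize_expTerm {β : Type*} (t : expLang.Term β) (v : β → ℝ) (k : ℕ) :
    (expTerm t k).realize v = itE k (t.realize v) := by
  induction k with
  | zero => rfl
  | succ k ih => rw [expTerm, realize_u, if_pos rfl, itE_succ, ih]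

/-- A variable or the constant zero as a term. -/
def baseTerm {α : Type*} : Option (α ⊕ Fin 0) → expLang.Term (α ⊕ Fin 0)
  | none => Term.func (L := expLang) (l := 0) (0 : Fin 2) Fin.elim0
  | some i => Term.var i

theorem realize_baseTerm {α : Type*} (o : Option (α ⊕ Fin 0)) (v : α → ℝ) (xs : Fin 0 → ℝ) :
    (baseTerm o).realize (Sum.elim v xs) = fam v xs o := by
  cases o <;> rfl

/-- The empty assignment. -/
def noBound : Fin 0 → ℝ := Fin.elim0

theorem realize_noBound {α : Type*} (φ : expLang.Formula α) (v : α → ℝ) :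
    φ.Realize v ↔ BoundedFormula.Realize φ v noBound := by
  exact iff_of_eq (congrArg (BoundedFormula.Realize φ v) (Subsingleton.elim _ _))

theorem qfDef_cmp {α : Type*} (i j : Option (α ⊕ Fin 0)) (k l : ℕ) :
    QFDef fun v : α → ℝ => itE k (fam v noBound i) < itE l (fam v noBound j) := by
  refine ⟨BoundedFormula.rel (L := expLang) (l := 2) ()
    ![expTerm (baseTerm i) k, expTerm (baseTerm j) l],
    (BoundedFormula.IsAtomic.rel _ _).isQF, fun v => ?_⟩
  rw [realize_noBound, realize_lt]
  simp [realize_expTerm, realize_baseTerm]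

theorem qfDef_of_finite {α : Type*} [Finite α] (φ : expLang.Formula α) :
    QFDef fun v => φ.Realize v := by
  let L := lev φ
  let I := (Option (α ⊕ Fin 0) × Fin (L + 1)) × (Option (α ⊕ Fin 0) × Fin (L + 1))
  let at' : I → (α → ℝ) → Prop := fun p v =>
    itE p.1.2 (fam v noBound p.1.1) < itE p.2.2 (fam v noBound p.2.1)
  have hat : ∀ p, QFDef (at' p) := fun p => qfDef_cmp _ _ _ _
  have key : QFDef fun v => ∃ T : I → Prop,
      (∃ w, φ.Realize w ∧ ∀ p, at' p w ↔ T p) ∧ ∀ p, at' p v ↔ T p := by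
    refine QFDef.exists_finite fun T => (qfDef_const _).and (QFDef.forall_finite fun p => ?_)
    exact (((hat p).imp (qfDef_const (T p))).and ((qfDef_const (T p)).imp (hat p))).congr
      fun v => by tauto
  refine key.congr fun v => ⟨fun h => ⟨fun p => at' p v, ⟨v, h, fun _ => Iff.rfl⟩,
    fun _ => Iff.rfl⟩, ?_⟩
  rintro ⟨T, ⟨w, hw, h1⟩, h2⟩
  rw [realize_noBound] at hw ⊢
  refine (realize_congr φ ?_).1 hw
  intro i j k hk l hl
  have e1 := h1 ((i, ⟨k, by omega⟩), (j, ⟨l, by omega⟩))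
  have e2 := h2 ((i, ⟨k, by omega⟩), (j, ⟨l, by omega⟩))
  exact e1.trans e2.symm

theorem qe_main (α : Type) (φ : expLang.Formula α) : ∃ ψ : expLang.Formula α,
      ψ.IsQF ∧ ∀ v : α → ℝ, φ.Realize v ↔ ψ.Realize v := by
  classical
  let φ' : expLang.Formula φ.freeVarFinset := BoundedFormula.restrictFreeVar φ id
  obtain ⟨ψ, hψ, h⟩ := qfDef_of_finite φ'
  refine ⟨Formula.relabel (fun a => a.1) ψ, BoundedFormula.IsQF.relabel hψ _, fun v => ?_⟩
  have h1 : φ'.Realize (fun a => v a.1) ↔ φ.Realize v :=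
    BoundedFormula.realize_restrictFreeVar (φ := φ) (f := id) v (by simp)
  rw [← h1, Formula.realize_relabel]
  exact h _

/-! ### A computable substructure -/

/-- Symbolic real numbers: `(j, p, q)` stands for the `j`-fold exponential of `-p / (q + 1)`. -/
abbrev Sym : Type := ℕ × ℕ × ℕ

/-- The value of a symbolic real. -/
noncomputable def val (s : Sym) : ℝ := itE s.1 (-((s.2.1 : ℝ) / ((s.2.2 : ℝ) + 1)))

/-- Comparison of symbolic reals. -/
def symLt (s t : Sym) : Prop :=
  s.1 < t.1 ∨ (s.1 = t.1 ∧ t.2.1 * (s.2.2 + 1) < s.2.1 * (t.2.2 + 1))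

instance symLtDec (s t : Sym) : Decidable (symLt s t) :=
  inferInstanceAs (Decidable (_ ∨ _))

theorem itE_lt_of_index_lt {j k : ℕ} {u w : ℝ} (hu : u ≤ 0) (h : j < k) : itE j u < itE k w := by
  obtain ⟨d, rfl⟩ : ∃ d, k = j + (d + 1) := ⟨k - j - 1, by omega⟩
  rw [itE_add, itE_lt_iff, itE_succ]
  exact hu.trans_lt (Real.exp_pos _)

theorem base_nonpos (p q : ℕ) : -((p : ℝ) / ((q : ℝ) + 1)) ≤ 0 := by
  have : (0 : ℝ) ≤ (p : ℝ) / ((q : ℝ) + 1) := by positivity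
  linarith

theorem val_lt_iff (s t : Sym) : val s < val t ↔ symLt s t := by
  obtain ⟨j, p, q⟩ := s
  obtain ⟨k, p', q'⟩ := t
  unfold val symLt
  simp only
  rcases lt_trichotomy j k with h | rfl | h
  · simp [h, itE_lt_of_index_lt (base_nonpos p q) h]
  · rw [itE_lt_iff, neg_lt_neg_iff, div_lt_div_iff₀ (by positivity) (by positivity)]
    simp only [lt_irrefl, true_and, false_or]
    exact_mod_cast Iff.rfl
  · have h1 := itE_lt_of_index_lt (w := -((p : ℝ) / ((q : ℝ) + 1))) (base_nonpos p' q') h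
    simp [h1.not_gt, h.not_gt, h.ne']

theorem val_eq_iff (s t : Sym) : val s = val t ↔ ¬ symLt s t ∧ ¬ symLt t s := by
  rw [← val_lt_iff, ← val_lt_iff, not_lt, not_lt, le_antisymm_iff, and_comm]

/-- Exponential of symbolic reals, iterated. -/
def symShift (k : ℕ) (s : Sym) : Sym := (s.1 + k, s.2)

theorem val_shift (k : ℕ) (s : Sym) : val (symShift k s) = itE k (val s) := by
  rw [val, symShift, add_comm, itE_add, val]

/-- Logarithm of symbolic reals. -/
def symLn (s : Sym) : Sym := if s.1 = 0 then (0, 0, 0) else (s.1 - 1, s.2)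

theorem val_zero : val (0, 0, 0) = 0 := by simp [val, itE_zero]

theorem val_one : val (1, 0, 0) = 1 := by simp [val, itE_succ, itE_zero]

theorem val_ln (s : Sym) : val (symLn s) = lnz (val s) := by
  obtain ⟨j, p, q⟩ := s
  unfold symLn lnz
  rcases j with _ | j
  · rw [if_pos rfl, val_zero, if_pos]
    exact base_nonpos p q
  · rw [if_neg (by simp)]
    have h : val (j + 1, p, q) = Real.exp (val (j, p, q)) := by
      simp [val, itE_succ]
    rw [h, if_neg (not_le.2 (Real.exp_pos _)), Real.log_exp]
    simp

/-- All shifts of the given symbolic reals and zero. -/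
def items (M : ℕ) (e : List Sym) : List Sym :=
  ((0, 0, 0) :: e).flatMap fun s => (List.range (2 * (M + 1) + 1)).map fun k => symShift k s

/-- Points at, above, and between two symbolic reals. -/
def between (s t : Sym) : List Sym :=
  [s, symShift 1 s, (s.1, s.2.1 + t.2.1, s.2.2 + t.2.2 + 1), (t.1, t.2.1 + t.2.2 + 1, t.2.2)]

/-- The test points for one quantifier. -/
def nextPts (M : ℕ) (e : List Sym) : List Sym :=
  ((items M e).flatMap fun s => (items M e).flatMap fun t => between s t).map
    fun s => (s.1 - (M + 1), s.2)

theorem exists_between_val {s t : Sym} (h : val s < val t) :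
    ∃ r ∈ between s t, val s < val r ∧ val r < val t := by
  rw [val_lt_iff] at h
  obtain ⟨j, p, q⟩ := s
  obtain ⟨k, p', q'⟩ := t
  rcases h with h | ⟨h1, h2⟩
  · refine ⟨(k, p' + q' + 1, q'), by simp [between], ?_, ?_⟩ <;> rw [val_lt_iff]
    · exact .inl h
    · refine .inr ⟨rfl, ?_⟩
      simp only
      nlinarith
  · simp only at h1 h2
    subst h1
    refine ⟨(j, p + p', q + q' + 1), by simp [between], ?_, ?_⟩ <;> rw [val_lt_iff] <;>
      refine .inr ⟨rfl, ?_⟩ <;> simp only <;> nlinarith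

theorem mem_items {M : ℕ} {e : List Sym} {s : Sym} (hs : s ∈ (0, 0, 0) :: e) {k : ℕ}
    (hk : k ≤ 2 * (M + 1)) : symShift k s ∈ items M e :=
  List.mem_flatMap.2 ⟨s, hs, List.mem_map.2 ⟨k, List.mem_range.2 (by omega), rfl⟩⟩

/-- The assignment given by a list of symbolic reals. -/
noncomputable def asg (n : ℕ) (e : List Sym) : Fin n → ℝ := fun i => val (e.getD i (0, 0, 0))

theorem nextPts_spec {M n : ℕ} {e : List Sym} (he : e.length = n) (v : Empty → ℝ) (a : ℝ) :
    ∃ x ∈ nextPts M e, SameCmp (M + 1) (fam v (Fin.snoc (asg n e) a))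
      (fam v (Fin.snoc (asg n e) (val x))) := by
  have hg : ∀ o, ∃ s ∈ (0, 0, 0) :: e, fam v (asg n e) o = val s := by
    rintro (_ | i | i)
    · exact ⟨_, List.mem_cons_self, val_zero.symm⟩
    · exact i.elim
    · refine ⟨e.getD i (0, 0, 0), List.mem_cons_of_mem _ ?_, rfl⟩
      have hi : (i : ℕ) < e.length := by rw [he]; exact i.2
      rw [List.getD_eq_getElem _ _ hi]
      exact List.getElem_mem hi
  have hC : ∀ s ∈ items M e, ∀ t ∈ items M e, ∀ r ∈ between s t,
      r ∈ (items M e).flatMap fun s => (items M e).flatMap fun t => between s t :=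
    fun s hs t ht r hr => List.mem_flatMap.2 ⟨s, hs, List.mem_flatMap.2 ⟨t, ht, hr⟩⟩
  have hrefl : ∀ L, SameCmp L (fam v (asg n e)) (fam v (asg n e)) :=
    fun L i j k _ l _ => Iff.rfl
  obtain ⟨b, ⟨s, hs, hsb⟩, h1, h2⟩ := exists_cut (M := M) none rfl rfl (hrefl _) a
    {r | ∃ s ∈ (items M e).flatMap fun s => (items M e).flatMap fun t => between s t, val s = r}
    (fun i k hk => by
      obtain ⟨s, hs, h⟩ := hg i
      have hm := mem_items hs hk
      exact ⟨_, hC _ hm _ hm (symShift k s) (by simp [between]), by rw [val_shift, h]⟩)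
    (fun i k hk => by
      obtain ⟨s, hs, h⟩ := hg i
      have hm := mem_items hs hk
      exact ⟨_, hC _ hm _ hm (symShift 1 (symShift k s)) (by simp [between]), by
        rw [val_shift, val_shift, h]; rfl⟩)
    (fun i j k hk l hl hlt => by
      obtain ⟨s, hs, h⟩ := hg i
      obtain ⟨t, ht, h'⟩ := hg j
      rw [h, h', ← val_shift, ← val_shift] at hlt
      obtain ⟨r, hr, hr1, hr2⟩ := exists_between_val hlt
      refine ⟨_, ⟨r, hC _ (mem_items hs hk) _ (mem_items ht hl) r hr, rfl⟩, ?_⟩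
      rw [h, h', ← val_shift, ← val_shift]
      exact ⟨hr1, hr2⟩)
  have hb : val (s.1 - (M + 1), s.2) = b := by
    have hle : M + 1 ≤ s.1 := by
      by_contra hcon
      have h3 : itE s.1 0 < itE (M + 1) b :=
        itE_lt_of_index_lt le_rfl (by omega)
      rw [← hsb, val, itE_lt_iff] at h3
      exact absurd h3 (base_nonpos _ _).not_gt
    have h4 : symShift (M + 1) (s.1 - (M + 1), s.2) = s := by
      simp [symShift, Nat.sub_add_cancel hle]
    apply (itE_strictMono (M + 1)).injective
    rw [← val_shift, h4, hsb]
  refine ⟨_, List.mem_map.2 ⟨s, hs, rfl⟩, ?_⟩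
  rw [hb]
  exact sameCmp_snoc (hrefl _) h1 h2

/-- All symbolic assignments of length `n` built from test points. -/
def cands (M : ℕ) : ℕ → List (List Sym)
  | 0 => [([] : List Sym)]
  | n + 1 => (cands M n).flatMap fun e => (nextPts M e).map fun x => e ++ [x]

theorem length_of_mem_cands {M : ℕ} : ∀ {n : ℕ} {e : List Sym}, e ∈ cands M n → e.length = n
  | 0, e, h => by simp_all [cands]
  | n + 1, e, h => by
    rw [cands, List.mem_flatMap] at h
    obtain ⟨e', he', h⟩ := h
    obtain ⟨x, -, rfl⟩ := List.mem_map.1 h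
    simp [length_of_mem_cands he']

theorem asg_append {n : ℕ} {e : List Sym} (he : e.length = n) (x : Sym) :
    asg (n + 1) (e ++ [x]) = Fin.snoc (asg n e) (val x) := by
  subst he
  funext i
  induction i using Fin.lastCases with
  | last => simp [asg]
  | cast i => simp [asg]

theorem realize_all_iff {M n : ℕ} (φ : expLang.BoundedFormula Empty (n + 1)) (hφ : lev φ ≤ M)
    (v : Empty → ℝ) {e : List Sym} (he : e.length = n) :
    φ.all.Realize v (asg n e) ↔ ∀ x ∈ nextPts M e, φ.Realize v (asg (n + 1) (e ++ [x])) := by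
  rw [BoundedFormula.realize_all]
  constructor
  · intro h x _
    rw [asg_append he]
    exact h _
  · intro h a
    obtain ⟨x, hx, hs⟩ := nextPts_spec (M := M) he v a
    refine (realize_congr φ (hs.mono (by omega))).2 ?_
    rw [← asg_append he]
    exact h x hx

/-! ### The decision procedure -/

/-- Decoding of a natural number as a list. -/
def toList (c : ℕ) : List ℕ := (Encodable.decode (α := List ℕ) c).getD []

/-- One step in evaluating a term. -/
def tstep (e : List Sym) (c : ℕ) (s : Sym) : Sym :=
  if c % 2 = 0 then e.getD (c / 2 / 2) (0, 0, 0)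
  else if (c / 2).unpair.1 = 0 then ((c / 2).unpair.2, 0, 0)
  else if (c / 2).unpair.2 = 0 then symShift 1 s
  else symLn s

/-- Evaluation of a coded term. -/
def tev (e : List Sym) (c : ℕ) : Sym := (toList c).foldr (tstep e) (0, 0, 0)

/-- Tables of satisfying assignments. -/
abbrev Table : Type := List (List Sym)

/-- Stack items: number of bound variables, possibly a term code, and a table. -/
abbrev Item : Type := ℕ × Option ℕ × Table

/-- Table of an equality. -/
def eqTable (M n t t' : ℕ) : Table :=
  (cands M n).filter fun e => ¬ symLt (tev e t) (tev e t') ∧ ¬ symLt (tev e t') (tev e t)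

/-- Table of an inequality. -/
def ltTable (M n t t' : ℕ) : Table :=
  (cands M n).filter fun e => symLt (tev e t) (tev e t')

/-- Table of an implication. -/
def impTable (M n : ℕ) (A B : Table) : Table :=
  (cands M n).filter fun e => ¬ e ∈ A ∨ e ∈ B

/-- Table of a universal quantification. -/
def allTable (M n : ℕ) (A : Table) : Table :=
  (cands M n).filter fun e => ((nextPts M e).map (fun x => e ++ [x])).all fun x => decide (x ∈ A)

/-- The formula on top of the stack. -/
def topF (M : ℕ) (st : List Item) : ℕ × Table :=
  if st.headI.2.1 = none then (st.headI.1, st.headI.2.2)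
  else (st.headI.1, eqTable M st.headI.1 (st.headI.2.1.getD 0) (st.tail.headI.2.1.getD 0))

/-- The stack without its top formula. -/
def popF (st : List Item) : List Item :=
  if st.headI.2.1 = none then st.tail else st.tail.tail

/-- The new stack in one step of the evaluation of a coded formula. -/
def newStack (M c : ℕ) (st : List Item × List Item) : List Item :=
  if c % 2 = 0 then ((c / 2).unpair.1, some (c / 2).unpair.2, []) :: st.1
  else if c / 2 % 2 = 0 then
    (st.2.headI.1, none,
      ltTable M st.2.headI.1 (st.2.headI.2.1.getD 0) (st.2.tail.headI.2.1.getD 0)) ::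
      st.2.tail.tail
  else if c / 2 / 2 = 0 then
    ((topF M st.1).1, none, impTable M (topF M st.1).1 (topF M st.1).2 (topF M (popF st.1)).2) ::
      popF (popF st.1)
  else if c / 2 / 2 = 1 then
    ((topF M st.1).1 - 1, none, allTable M ((topF M st.1).1 - 1) (topF M st.1).2) :: popF st.1
  else (c / 2 / 2 - 2, none, []) :: st.1

/-- One step of the evaluation of a coded formula. -/
def fstep (M c : ℕ) (st : List Item × List Item) : List Item × List Item :=
  (newStack M c st, st.1)

/-- The decision procedure. -/
def decider (c : ℕ) : Bool :=
  decide ([] ∈ (topF (4 ^ c) ((toList c).foldr (fstep (4 ^ c)) ([], [])).1).2)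

theorem toList_encode {α : Type*} [Encodable α] (l : List α) :
    toList (Encodable.encode l) = l.map Encodable.encode := by
  have h : Encodable.encode l = Encodable.encode (l.map Encodable.encode) := by
    induction l with
    | nil => rfl
    | cons a l ih => rw [List.map_cons, Encodable.encode_list_cons, Encodable.encode_list_cons, ih]; rfl
  rw [h, toList, Encodable.encodek]
  rfl

theorem code_var {F : Type*} [Encodable F] {n : ℕ} (i : Fin n) :
    Encodable.encode (Sum.inl (Sum.inr i) : (Empty ⊕ Fin n) ⊕ F) = 2 * (2 * i + 1) := rfl

theorem code_fun {n l : ℕ} (f : expLang.Functions l) :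
    Encodable.encode (Sum.inr ⟨l, f⟩ : (Empty ⊕ Fin n) ⊕ (Σ i, expLang.Functions i)) =
      2 * Nat.pair l (Encodable.encode f) + 1 := rfl

theorem tstep_var (e : List Sym) (i : ℕ) (s : Sym) :
    tstep e (2 * (2 * i + 1)) s = e.getD i (0, 0, 0) := by
  have h1 : 2 * (2 * i + 1) % 2 = 0 := by omega
  have h2 : 2 * (2 * i + 1) / 2 / 2 = i := by omega
  rw [tstep, if_pos h1, h2]

theorem tstep_fun (e : List Sym) (l f : ℕ) (s : Sym) :
    tstep e (2 * Nat.pair l f + 1) s =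
      if l = 0 then (f, 0, 0) else if f = 0 then symShift 1 s else symLn s := by
  have h1 : ¬ (2 * Nat.pair l f + 1) % 2 = 0 := by omega
  have h2 : (2 * Nat.pair l f + 1) / 2 = Nat.pair l f := by omega
  rw [tstep, if_neg h1, h2, Nat.unpair_pair]

theorem tev_encode {n : ℕ} (e : List Sym) (v : Empty → ℝ)
    (t : expLang.Term (Empty ⊕ Fin n)) :
    val (tev e (Encodable.encode t)) = t.realize (Sum.elim v (asg n e)) := by
  have h0 : Encodable.encode t = Encodable.encode t.listEncode := rfl
  rw [h0, tev, toList_encode]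
  clear h0
  induction t using term_ind with
  | hv i =>
    rcases i with i | i
    · exact i.elim
    · rw [Term.listEncode, List.map_cons, code_var, List.foldr_cons, tstep_var]
      rfl
  | hc c ts =>
    rw [realize_c, Term.listEncode, List.map_cons, code_fun, List.foldr_cons, tstep_fun, if_pos rfl]
    have : Encodable.encode (α := expLang.Functions 0) c = c.val := rfl
    rw [this]
    fin_cases c
    · simpa using val_zero
    · simpa using val_one
  | hu c ts ih =>
    rw [realize_u, Term.listEncode, List.map_cons, code_fun, List.foldr_cons, tstep_fun,
      if_neg one_ne_zero]
    have : Encodable.encode (α := expLang.Functions 1) c = c.val := rfl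
    have h2 : (List.finRange 1).flatMap (fun i => (ts i).listEncode) = (ts 0).listEncode := by
      simp [List.finRange_succ]
    rw [this, h2]
    fin_cases c
    · simp [val_shift, ih, itE]
    · simp [val_ln, ih]

/-! ### Correctness -/

/-- The symbols in the encoding of formulas. -/
abbrev FSym : Type :=
  (Σ k, expLang.Term (Empty ⊕ Fin k)) ⊕ ((Σ n, expLang.Relations n) ⊕ ℕ)

theorem code_term {n : ℕ} (t : expLang.Term (Empty ⊕ Fin n)) :
    Encodable.encode (Sum.inl ⟨n, t⟩ : FSym) = 2 * Nat.pair n (Encodable.encode t) := rfl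

theorem code_rel {l : ℕ} (r : expLang.Relations l) :
    Encodable.encode (Sum.inr (Sum.inl ⟨l, r⟩) : FSym) =
      2 * (2 * Nat.pair l (Encodable.encode r)) + 1 := rfl

theorem code_num (k : ℕ) :
    Encodable.encode (Sum.inr (Sum.inr k) : FSym) = 2 * (2 * k + 1) + 1 := rfl

theorem newStack_term (M n c : ℕ) (st : List Item × List Item) :
    newStack M (2 * Nat.pair n c) st = (n, some c, []) :: st.1 := by
  have h1 : 2 * Nat.pair n c % 2 = 0 := by omega
  have h2 : 2 * Nat.pair n c / 2 = Nat.pair n c := by omega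
  rw [newStack, if_pos h1, h2, Nat.unpair_pair]

theorem newStack_rel (M c : ℕ) (st : List Item × List Item) :
    newStack M (2 * (2 * c) + 1) st = (st.2.headI.1, none,
      ltTable M st.2.headI.1 (st.2.headI.2.1.getD 0) (st.2.tail.headI.2.1.getD 0)) ::
      st.2.tail.tail := by
  have h1 : ¬ (2 * (2 * c) + 1) % 2 = 0 := by omega
  have h2 : (2 * (2 * c) + 1) / 2 % 2 = 0 := by omega
  rw [newStack, if_neg h1, if_pos h2]

theorem newStack_num (M k : ℕ) (st : List Item × List Item) :
    newStack M (2 * (2 * k + 1) + 1) st =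
      if k = 0 then
        ((topF M st.1).1, none,
          impTable M (topF M st.1).1 (topF M st.1).2 (topF M (popF st.1)).2) :: popF (popF st.1)
      else if k = 1 then
        ((topF M st.1).1 - 1, none, allTable M ((topF M st.1).1 - 1) (topF M st.1).2) :: popF st.1
      else (k - 2, none, []) :: st.1 := by
  have h1 : ¬ (2 * (2 * k + 1) + 1) % 2 = 0 := by omega
  have h2 : ¬ (2 * (2 * k + 1) + 1) / 2 % 2 = 0 := by omega
  have h3 : (2 * (2 * k + 1) + 1) / 2 / 2 = k := by omega
  rw [newStack, if_neg h1, if_neg h2, h3]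

theorem topF_none (M n : ℕ) (A : Table) (st : List Item) :
    topF M ((n, none, A) :: st) = (n, A) := by simp [topF]

theorem popF_none (n : ℕ) (A : Table) (st : List Item) : popF ((n, none, A) :: st) = st := by
  simp [popF]

/-- Running the evaluation on the symbols of a formula. -/
def runF (M : ℕ) (l : List FSym) (st : List Item × List Item) : List Item × List Item :=
  (l.map Encodable.encode).foldr (fstep M) st

theorem runF_cons (M : ℕ) (a : FSym) (l : List FSym) (st : List Item × List Item) :
    runF M (a :: l) st = fstep M (Encodable.encode a) (runF M l st) := rfl

theorem runF_append (M : ℕ) (l l' : List FSym) (st : List Item × List Item) :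
    runF M (l ++ l') st = runF M l (runF M l' st) := by
  simp [runF]

theorem fold_correct {M : ℕ} (v : Empty → ℝ) {n : ℕ} (φ : expLang.BoundedFormula Empty n) :
    lev φ ≤ M → ∀ st,
      (topF M (runF M φ.listEncode st).1).1 = n ∧ popF (runF M φ.listEncode st).1 = st.1 ∧
      ∀ e, e ∈ (topF M (runF M φ.listEncode st).1).2 ↔ e ∈ cands M n ∧ φ.Realize v (asg n e) := by
  induction φ with
  | @falsum n =>
    intro _ st
    have h : (runF M (BoundedFormula.falsum (L := expLang) (α := Empty) (n := n)).listEncode st).1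
        = (n, none, []) :: st.1 := by
      rw [BoundedFormula.listEncode, runF_cons, fstep, code_num, newStack_num]
      simp [runF]
    rw [h, topF_none, popF_none]
    refine ⟨rfl, rfl, fun e => ?_⟩
    simp [BoundedFormula.Realize]
  | @equal n t₁ t₂ =>
    intro _ st
    have h : (runF M (BoundedFormula.equal t₁ t₂).listEncode st).1
        = (n, some (Encodable.encode t₁), []) :: (n, some (Encodable.encode t₂), []) :: st.1 := by
      rw [BoundedFormula.listEncode, runF_cons, runF_cons, fstep, fstep, code_term, code_term,
        newStack_term, newStack_term]
      rfl
    rw [h]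
    refine ⟨by simp [topF], by simp [popF], fun e => ?_⟩
    simp [topF, eqTable, BoundedFormula.Realize, ← tev_encode, val_eq_iff]
    exact fun _ => decide_eq_true_iff
  | @rel n l R ts =>
    intro _ st
    match l, R with
    | 0, R => exact R.elim
    | 1, R => exact R.elim
    | _ + 3, R => exact R.elim
    | 2, R =>
      have h : (runF M (BoundedFormula.rel R ts).listEncode st).1
          = (n, none, ltTable M n (Encodable.encode (ts 0)) (Encodable.encode (ts 1))) :: st.1 := by
        rw [BoundedFormula.listEncode, List.cons_append, List.cons_append, List.nil_append,
          runF_cons, runF_cons, fstep, code_rel, newStack_rel]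
        have : (List.finRange 2).map (fun i => (Sum.inl ⟨n, ts i⟩ : FSym))
          = [Sum.inl ⟨n, ts 0⟩, Sum.inl ⟨n, ts 1⟩] := by
          simp [List.finRange_succ]
        rw [this, fstep, runF_cons, runF_cons, fstep, fstep, code_term, code_term, newStack_term,
          newStack_term]
        rfl
      rw [h, topF_none, popF_none]
      refine ⟨rfl, rfl, fun e => ?_⟩
      rw [realize_lt, ← tev_encode, ← tev_encode, val_lt_iff]
      simp [ltTable]
  | @imp n φ ψ ih1 ih2 =>
    intro hM st
    rw [lev] at hM
    obtain ⟨a1, a2, a3⟩ := ih2 (by omega) st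
    obtain ⟨b1, b2, b3⟩ := ih1 (by omega) (runF M ψ.listEncode st)
    rw [BoundedFormula.listEncode, List.cons_append, runF_cons, runF_append, fstep, code_num,
      newStack_num, if_pos rfl, topF_none, popF_none, b2, a2, b1]
    refine ⟨rfl, rfl, fun e => ?_⟩
    rw [BoundedFormula.realize_imp]
    simp only [impTable, List.mem_filter, decide_eq_true_eq, a3, b3]
    tauto
  | @all n φ ih =>
    intro hM st
    rw [lev] at hM
    obtain ⟨a1, a2, a3⟩ := ih (by omega) st
    rw [BoundedFormula.listEncode, runF_cons, fstep, code_num,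
      newStack_num, if_neg one_ne_zero, if_pos rfl, topF_none, popF_none, a2, a1]
    refine ⟨rfl, rfl, fun e => ?_⟩
    rw [Nat.add_sub_cancel, allTable, List.mem_filter]
    refine and_congr_right fun he => ?_
    rw [realize_all_iff φ (M := M) (by omega) v (length_of_mem_cands he)]
    simp only [List.all_eq_true, List.mem_map, decide_eq_true_eq, a3]
    constructor
    · intro h x hx
      exact (h _ ⟨x, hx, rfl⟩).2
    · rintro h _ ⟨x, hx, rfl⟩
      refine ⟨?_, h x hx⟩
      rw [cands, List.mem_flatMap]
      exact ⟨e, he, List.mem_map.2 ⟨x, hx, rfl⟩⟩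

theorem length_le_encode {α : Type*} [Encodable α] (l : List α) :
    l.length ≤ Encodable.encode l := by
  induction l with
  | nil => exact Nat.zero_le _
  | cons a l ih =>
    rw [Encodable.encode_list_cons, List.length_cons]
    have := Nat.right_le_pair (Encodable.encode a) (Encodable.encode l)
    omega

theorem tdepth_le_encode {n : ℕ} (t : expLang.Term (Empty ⊕ Fin n)) :
    tdepth t ≤ Encodable.encode t := by
  refine le_trans ?_ (length_le_encode t.listEncode)
  induction t using term_ind with
  | hv i => exact Nat.zero_le _
  | hc c ts => rw [tdepth_c, Term.listEncode, List.length_cons]; omega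
  | hu c ts ih =>
    have h2 : (List.finRange 1).flatMap (fun i => (ts i).listEncode) = (ts 0).listEncode := by
      simp [List.finRange_succ]
    rw [tdepth_u, Term.listEncode, List.length_cons, h2]
    omega

/-- A size measure. -/
def cost (l : List FSym) : ℕ := (l.map fun a => Encodable.encode a + 1).sum

theorem cost_le_encode (l : List FSym) : cost l ≤ Encodable.encode l := by
  induction l with
  | nil => exact Nat.zero_le _
  | cons a l ih =>
    rw [Encodable.encode_list_cons]
    have := Nat.add_le_pair (Encodable.encode a) (Encodable.encode l)
    simp only [cost, List.map_cons, List.sum_cons] at ih ⊢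
    omega

theorem le_four_pow (x : ℕ) : 2 * x ≤ 4 ^ x := by
  induction x with
  | zero => simp
  | succ x ih =>
    rw [pow_succ]
    have := Nat.one_le_pow x 4 (by norm_num)
    omega

theorem tdepth_le_code {n : ℕ} (t : expLang.Term (Empty ⊕ Fin n)) :
    tdepth t ≤ Encodable.encode (Sum.inl ⟨n, t⟩ : FSym) := by
  rw [code_term]
  have := Nat.right_le_pair n (Encodable.encode t)
  have := tdepth_le_encode t
  omega

theorem lev_le_cost {n : ℕ} (φ : expLang.BoundedFormula Empty n) :
    lev φ ≤ 4 ^ cost φ.listEncode := by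
  induction φ with
  | falsum => exact Nat.zero_le _
  | equal t₁ t₂ =>
    refine le_trans ?_ (le_four_pow _)
    have h1 := tdepth_le_code t₁
    have h2 := tdepth_le_code t₂
    simp only [lev, BoundedFormula.listEncode, cost, List.map_cons, List.sum_cons]
    omega
  | @rel n l R ts =>
    match l, R with
    | 0, R => exact R.elim
    | 1, R => exact R.elim
    | _ + 3, R => exact R.elim
    | 2, R =>
      refine le_trans ?_ (le_four_pow _)
      have h1 := tdepth_le_code (ts 0)
      have h2 := tdepth_le_code (ts 1)
      have : (List.finRange 2).map (fun i => (Sum.inl ⟨n, ts i⟩ : FSym))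
        = [Sum.inl ⟨n, ts 0⟩, Sum.inl ⟨n, ts 1⟩] := by
        simp [List.finRange_succ]
      rw [lev, Fin.sum_univ_two, BoundedFormula.listEncode, this]
      simp only [cost, List.map_cons, List.sum_cons, List.cons_append, List.nil_append]
      omega
  | imp φ ψ ih1 ih2 =>
    have h : cost (BoundedFormula.imp φ ψ).listEncode =
        Encodable.encode (Sum.inr (Sum.inr 0) : FSym) + 1 +
          (cost φ.listEncode + cost ψ.listEncode) := by
      simp [cost, BoundedFormula.listEncode, add_assoc]
    rw [h, lev, pow_add, pow_add, pow_add]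
    have h1 := Nat.one_le_pow (cost φ.listEncode) 4 (by norm_num)
    have h2 := Nat.one_le_pow (cost ψ.listEncode) 4 (by norm_num)
    have h3 := Nat.one_le_pow (Encodable.encode (Sum.inr (Sum.inr 0) : FSym)) 4 (by norm_num)
    generalize 4 ^ cost φ.listEncode = a at *
    generalize 4 ^ cost ψ.listEncode = b at *
    generalize 4 ^ Encodable.encode (Sum.inr (Sum.inr 0) : FSym) = c at *
    calc lev φ + lev ψ ≤ a + b := by omega
      _ ≤ 4 * (a * b) := by nlinarith
      _ ≤ c * (4 * (a * b)) := Nat.le_mul_of_pos_left _ (by omega)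
      _ = _ := by ring
  | all φ ih =>
    have h : cost (BoundedFormula.all φ).listEncode =
        Encodable.encode (Sum.inr (Sum.inr 1) : FSym) + 1 + cost φ.listEncode := by
      simp [cost, BoundedFormula.listEncode, add_assoc]
    rw [h, lev, pow_add, pow_add]
    have h1 := Nat.one_le_pow (cost φ.listEncode) 4 (by norm_num)
    have h3 := Nat.one_le_pow (Encodable.encode (Sum.inr (Sum.inr 1) : FSym)) 4 (by norm_num)
    generalize 4 ^ cost φ.listEncode = a at *
    generalize 4 ^ Encodable.encode (Sum.inr (Sum.inr 1) : FSym) = c at *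
    calc 2 * (lev φ + 1) ≤ 4 * a := by omega
      _ ≤ c * (4 * a) := Nat.le_mul_of_pos_left _ (by omega)
      _ = _ := by ring

theorem decider_correct (φ : expLang.Sentence) :
    φ ∈ expLang.completeTheory ℝ ↔ decider (Encodable.encode φ) = true := by
  have h0 : Encodable.encode φ = Encodable.encode (BoundedFormula.listEncode φ) := rfl
  have hl : lev φ ≤ 4 ^ Encodable.encode φ :=
    (lev_le_cost φ).trans (Nat.pow_le_pow_right (by norm_num) (by rw [h0]; exact cost_le_encode _))
  have h1 : toList (Encodable.encode φ) = (BoundedFormula.listEncode φ).map Encodable.encode := by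
    rw [h0, toList_encode]
  have h := (fold_correct (default : Empty → ℝ) φ hl ([], [])).2.2 []
  rw [decider, decide_eq_true_iff, h1]
  refine Iff.trans ?_ h.symm
  have hc : ([] : List Sym) ∈ cands (4 ^ Encodable.encode φ) 0 := by simp [cands]
  rw [and_iff_right hc]
  change BoundedFormula.Realize φ _ _ ↔ _
  refine iff_of_eq (congrArg₂ (BoundedFormula.Realize φ) ?_ ?_) <;> exact Subsingleton.elim _ _

/-! ### Primitive recursiveness -/

section Prim

variable {α : Type} [Primcodable α]

theorem symLt_pr {f g : α → Sym} (hf : Primrec f) (hg : Primrec g) :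
    PrimrecPred fun a => symLt (f a) (g a) := by
  have f1 := Primrec.fst.comp hf
  have f2 := Primrec.fst.comp (Primrec.snd.comp hf)
  have f3 := Primrec.succ.comp (Primrec.snd.comp (Primrec.snd.comp hf))
  have g1 := Primrec.fst.comp hg
  have g2 := Primrec.fst.comp (Primrec.snd.comp hg)
  have g3 := Primrec.succ.comp (Primrec.snd.comp (Primrec.snd.comp hg))
  exact (Primrec.nat_lt.comp f1 g1).or ((Primrec.eq.comp f1 g1).and
    (Primrec.nat_lt.comp (Primrec.nat_mul.comp g2 f3) (Primrec.nat_mul.comp f2 g3)))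

theorem symShift_pr {k : α → ℕ} {f : α → Sym} (hk : Primrec k) (hf : Primrec f) :
    Primrec fun a => symShift (k a) (f a) :=
  (Primrec.nat_add.comp (Primrec.fst.comp hf) hk).pair (Primrec.snd.comp hf)

theorem symLn_pr {f : α → Sym} (hf : Primrec f) : Primrec fun a => symLn (f a) :=
  Primrec.ite (Primrec.eq.comp (Primrec.fst.comp hf) (Primrec.const 0)) (Primrec.const _)
    ((Primrec.nat_sub.comp (Primrec.fst.comp hf) (Primrec.const 1)).pair (Primrec.snd.comp hf))

theorem items_pr {M : α → ℕ} {e : α → List Sym} (hM : Primrec M) (he : Primrec e) :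
    Primrec fun a => items (M a) (e a) := by
  refine Primrec.list_flatMap (Primrec.list_cons.comp (Primrec.const _) he) ?_
  refine Primrec.list_map (Primrec.list_range.comp ?_) ?_
  · exact Primrec.succ.comp (Primrec.nat_mul.comp (Primrec.const 2)
      (Primrec.succ.comp (hM.comp Primrec.fst)))
  · exact symShift_pr Primrec.snd (Primrec.snd.comp Primrec.fst)

theorem between_pr {f g : α → Sym} (hf : Primrec f) (hg : Primrec g) :
    Primrec fun a => between (f a) (g a) := by
  have f1 := Primrec.fst.comp hf
  have f2 := Primrec.fst.comp (Primrec.snd.comp hf)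
  have f3 := Primrec.snd.comp (Primrec.snd.comp hf)
  have g1 := Primrec.fst.comp hg
  have g2 := Primrec.fst.comp (Primrec.snd.comp hg)
  have g3 := Primrec.snd.comp (Primrec.snd.comp hg)
  refine Primrec.list_cons.comp hf (Primrec.list_cons.comp
    (symShift_pr (Primrec.const 1) hf) (Primrec.list_cons.comp ?_
      (Primrec.list_cons.comp ?_ (Primrec.const []))))
  · exact f1.pair ((Primrec.nat_add.comp f2 g2).pair (Primrec.succ.comp (Primrec.nat_add.comp f3 g3)))
  · exact g1.pair ((Primrec.succ.comp (Primrec.nat_add.comp g2 g3)).pair g3)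

theorem nextPts_pr {M : α → ℕ} {e : α → List Sym} (hM : Primrec M) (he : Primrec e) :
    Primrec fun a => nextPts (M a) (e a) := by
  refine Primrec.list_map (Primrec.list_flatMap (items_pr hM he)
    (Primrec.list_flatMap (items_pr (hM.comp Primrec.fst) (he.comp Primrec.fst)) ?_)) ?_
  · exact between_pr (Primrec.snd.comp Primrec.fst) Primrec.snd
  · exact (Primrec.nat_sub.comp (Primrec.fst.comp Primrec.snd)
      (Primrec.succ.comp (hM.comp Primrec.fst))).pair (Primrec.snd.comp Primrec.snd)

theorem exts_pr {M : α → ℕ} {e : α → List Sym} (hM : Primrec M) (he : Primrec e) :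
    Primrec fun a => (nextPts (M a) (e a)).map fun x => e a ++ [x] :=
  Primrec.list_map (nextPts_pr hM he)
    (Primrec.list_concat.comp (he.comp Primrec.fst) Primrec.snd)

theorem cands_pr {M n : α → ℕ} (hM : Primrec M) (hn : Primrec n) :
    Primrec fun a => cands (M a) (n a) := by
  have h : Primrec fun a => (n a).rec (motive := fun _ => List (List Sym)) [([] : List Sym)]
      fun _ (IH : List (List Sym)) =>
        IH.flatMap fun e => (nextPts (M a) e).map fun x => e ++ [x] := by
    refine Primrec.nat_rec' (h := fun a (p : ℕ × List (List Sym)) =>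
        p.2.flatMap fun e => (nextPts (M a) e).map fun x => e ++ [x]) hn (Primrec.const _) ?_
    refine Primrec.list_flatMap (Primrec.snd.comp Primrec.snd) ?_
    exact exts_pr (hM.comp (Primrec.fst.comp Primrec.fst)) Primrec.snd
  refine h.of_eq fun a => ?_
  induction n a with
  | zero => rfl
  | succ k ih => rw [cands, ← ih]

theorem toList_pr {c : α → ℕ} (hc : Primrec c) : Primrec fun a => toList (c a) :=
  Primrec.option_getD.comp (Primrec.decode.comp hc) (Primrec.const [])

theorem half_pr {c : α → ℕ} (hc : Primrec c) : Primrec fun a => c a / 2 :=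
  Primrec.nat_div.comp hc (Primrec.const 2)

theorem parity_pr {c : α → ℕ} (hc : Primrec c) : PrimrecPred fun a => c a % 2 = 0 :=
  Primrec.eq.comp (Primrec.nat_mod.comp hc (Primrec.const 2)) (Primrec.const 0)

theorem isK_pr {c : α → ℕ} (hc : Primrec c) (k : ℕ) : PrimrecPred fun a => c a = k :=
  Primrec.eq.comp hc (Primrec.const k)

theorem tstep_pr {e : α → List Sym} {c : α → ℕ} {s : α → Sym} (he : Primrec e) (hc : Primrec c)
    (hs : Primrec s) : Primrec fun a => tstep (e a) (c a) (s a) := by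
  have hu := Primrec.unpair.comp (half_pr hc)
  refine Primrec.ite (parity_pr hc) ((Primrec.list_getD _).comp he (half_pr (half_pr hc))) ?_
  refine Primrec.ite (isK_pr (Primrec.fst.comp hu) 0)
    ((Primrec.snd.comp hu).pair (Primrec.const _)) ?_
  exact Primrec.ite (isK_pr (Primrec.snd.comp hu) 0) (symShift_pr (Primrec.const 1) hs)
    (symLn_pr hs)

theorem tev_pr {e : α → List Sym} {c : α → ℕ} (he : Primrec e) (hc : Primrec c) :
    Primrec fun a => tev (e a) (c a) := by
  refine Primrec.list_foldr (h := fun a (p : ℕ × Sym) => tstep (e a) p.1 p.2)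
    (toList_pr hc) (Primrec.const _) ?_
  exact tstep_pr (he.comp Primrec.fst) (Primrec.fst.comp Primrec.snd)
    (Primrec.snd.comp Primrec.snd)

theorem filter_pr {β : Type} [Primcodable β] {l : α → List β} {p : α → β → Bool}
    (hl : Primrec l) (hp : Primrec₂ p) : Primrec fun a => (l a).filter (p a) := by
  have h : Primrec fun a => (l a).flatMap fun b => if p a b = true then [b] else [] := by
    refine Primrec.list_flatMap hl (Primrec.ite ?_ ?_ (Primrec.const []))
    · exact Primrec.eq.comp hp (Primrec.const true)
    · exact Primrec.list_cons.comp Primrec.snd (Primrec.const [])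
  refine h.of_eq fun a => ?_
  induction l a with
  | nil => rfl
  | cons b l ih =>
    rw [List.flatMap_cons, ih, List.filter_cons]
    split <;> rfl

theorem mem_pr {β : Type} [Primcodable β] {b : α → β} {l : α → List β} (hb : Primrec b)
    (hl : Primrec l) : PrimrecPred fun a => b a ∈ l a := by
  have h : PrimrecPred fun a => ∃ x ∈ l a, x = b a :=
    (PrimrecRel.exists_mem_list (R := fun x y : β => x = y) Primrec.eq).comp hl hb
  exact h.of_eq fun a => by simp

theorem eqTable_pr {M n t t' : α → ℕ} (hM : Primrec M) (hn : Primrec n) (ht : Primrec t)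
    (ht' : Primrec t') : Primrec fun a => eqTable (M a) (n a) (t a) (t' a) := by
  refine filter_pr (cands_pr hM hn) ?_
  have h1 : Primrec fun p : α × List Sym => tev p.2 (t p.1) :=
    tev_pr Primrec.snd (ht.comp Primrec.fst)
  have h2 : Primrec fun p : α × List Sym => tev p.2 (t' p.1) :=
    tev_pr Primrec.snd (ht'.comp Primrec.fst)
  exact ((symLt_pr h1 h2).not.and (symLt_pr h2 h1).not).decide

theorem ltTable_pr {M n t t' : α → ℕ} (hM : Primrec M) (hn : Primrec n) (ht : Primrec t)
    (ht' : Primrec t') : Primrec fun a => ltTable (M a) (n a) (t a) (t' a) := by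
  refine filter_pr (cands_pr hM hn) ?_
  have h1 : Primrec fun p : α × List Sym => tev p.2 (t p.1) :=
    tev_pr Primrec.snd (ht.comp Primrec.fst)
  have h2 : Primrec fun p : α × List Sym => tev p.2 (t' p.1) :=
    tev_pr Primrec.snd (ht'.comp Primrec.fst)
  exact (symLt_pr h1 h2).decide

theorem impTable_pr {M n : α → ℕ} {A B : α → Table} (hM : Primrec M) (hn : Primrec n)
    (hA : Primrec A) (hB : Primrec B) :
    Primrec fun a => impTable (M a) (n a) (A a) (B a) := by
  refine filter_pr (cands_pr hM hn) ?_
  have h1 : PrimrecPred fun p : α × List Sym => p.2 ∈ A p.1 :=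
    mem_pr Primrec.snd (hA.comp Primrec.fst)
  have h2 : PrimrecPred fun p : α × List Sym => p.2 ∈ B p.1 :=
    mem_pr Primrec.snd (hB.comp Primrec.fst)
  exact (h1.not.or h2).decide

theorem allTable_pr {M n : α → ℕ} {A : α → Table} (hM : Primrec M) (hn : Primrec n)
    (hA : Primrec A) : Primrec fun a => allTable (M a) (n a) (A a) := by
  refine filter_pr (cands_pr hM hn) ?_
  have hr : PrimrecRel fun (x : List Sym) (T : Table) => x ∈ T :=
    mem_pr Primrec.fst Primrec.snd
  have h1 : PrimrecPred fun p : α × List Sym =>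
      ∀ x ∈ (nextPts (M p.1) p.2).map (fun x => p.2 ++ [x]), x ∈ A p.1 :=
    hr.forall_mem_list.comp (exts_pr (hM.comp Primrec.fst) Primrec.snd) (hA.comp Primrec.fst)
  obtain ⟨_, h⟩ := h1
  refine h.of_eq fun p => ?_
  rw [Bool.eq_iff_iff, decide_eq_true_iff, List.all_eq_true]
  simp only [decide_eq_true_iff]

theorem topF_pr {M : α → ℕ} {st : α → List Item} (hM : Primrec M) (hst : Primrec st) :
    Primrec fun a => topF (M a) (st a) := by
  have h1 := Primrec.list_headI.comp hst
  have h2 := Primrec.list_headI.comp (Primrec.list_tail.comp hst)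
  have k1 := Primrec.fst.comp (Primrec.snd.comp h1)
  have k2 := Primrec.fst.comp (Primrec.snd.comp h2)
  refine Primrec.ite (Primrec.eq.comp k1 (Primrec.const none))
    ((Primrec.fst.comp h1).pair (Primrec.snd.comp (Primrec.snd.comp h1)))
    ((Primrec.fst.comp h1).pair ?_)
  exact eqTable_pr hM (Primrec.fst.comp h1) (Primrec.option_getD.comp k1 (Primrec.const 0))
    (Primrec.option_getD.comp k2 (Primrec.const 0))

theorem popF_pr {st : α → List Item} (hst : Primrec st) : Primrec fun a => popF (st a) :=
  Primrec.ite (Primrec.eq.comp (Primrec.fst.comp (Primrec.snd.comp (Primrec.list_headI.comp hst)))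
    (Primrec.const none)) (Primrec.list_tail.comp hst)
    (Primrec.list_tail.comp (Primrec.list_tail.comp hst))

theorem newStack_pr {M c : α → ℕ} {st : α → List Item × List Item} (hM : Primrec M)
    (hc : Primrec c) (hst : Primrec st) : Primrec fun a => newStack (M a) (c a) (st a) := by
  have hu := Primrec.unpair.comp (half_pr hc)
  have s1 := Primrec.fst.comp hst
  have s2 := Primrec.snd.comp hst
  have h1 := Primrec.list_headI.comp s2
  have h2 := Primrec.list_headI.comp (Primrec.list_tail.comp s2)
  have k1 := Primrec.fst.comp (Primrec.snd.comp h1)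
  have k2 := Primrec.fst.comp (Primrec.snd.comp h2)
  have t1 := topF_pr hM s1
  have t2 := topF_pr hM (popF_pr s1)
  have q := half_pr (half_pr hc)
  refine Primrec.ite (parity_pr hc) ?_ (Primrec.ite (parity_pr (half_pr hc)) ?_
    (Primrec.ite (isK_pr q 0) ?_ (Primrec.ite (isK_pr q 1) ?_ ?_)))
  · exact Primrec.list_cons.comp ((Primrec.fst.comp hu).pair
      ((Primrec.option_some.comp (Primrec.snd.comp hu)).pair (Primrec.const []))) s1
  · exact Primrec.list_cons.comp ((Primrec.fst.comp h1).pair ((Primrec.const none).pair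
      (ltTable_pr hM (Primrec.fst.comp h1) (Primrec.option_getD.comp k1 (Primrec.const 0))
        (Primrec.option_getD.comp k2 (Primrec.const 0)))))
      (Primrec.list_tail.comp (Primrec.list_tail.comp s2))
  · exact Primrec.list_cons.comp ((Primrec.fst.comp t1).pair ((Primrec.const none).pair
      (impTable_pr hM (Primrec.fst.comp t1) (Primrec.snd.comp t1) (Primrec.snd.comp t2))))
      (popF_pr (popF_pr s1))
  · have hp := Primrec.nat_sub.comp (Primrec.fst.comp t1) (Primrec.const 1)
    exact Primrec.list_cons.comp (hp.pair ((Primrec.const none).pair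
      (allTable_pr hM hp (Primrec.snd.comp t1)))) (popF_pr s1)
  · exact Primrec.list_cons.comp ((Primrec.nat_sub.comp q (Primrec.const 2)).pair
      (Primrec.const (none, []))) s1

end Prim

theorem pow_pr : Primrec fun c : ℕ => 4 ^ c := by
  have h : Primrec fun c : ℕ => c.rec (motive := fun _ => ℕ) 1 fun _ IH => IH * 4 :=
    Primrec.nat_rec₁ 1 (Primrec.nat_mul.comp Primrec.snd (Primrec.const 4))
  refine h.of_eq fun c => ?_
  induction c with
  | zero => rfl
  | succ k ih => rw [pow_succ, ← ih]

theorem decider_pr : Primrec decider := by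
  have hfold : Primrec fun c : ℕ => (toList c).foldr (fstep (4 ^ c)) ([], []) := by
    refine Primrec.list_foldr (h := fun c (p : ℕ × (List Item × List Item)) =>
      fstep (4 ^ c) p.1 p.2) (toList_pr Primrec.id) (Primrec.const _) ?_
    exact (newStack_pr (pow_pr.comp Primrec.fst) (Primrec.fst.comp Primrec.snd)
      (Primrec.snd.comp Primrec.snd)).pair (Primrec.fst.comp (Primrec.snd.comp Primrec.snd))
  exact (mem_pr (Primrec.const []) (Primrec.snd.comp
    (topF_pr pow_pr (Primrec.fst.comp hfold)))).decide

theorem dec_main : DecidableVia (expLang.completeTheory ℝ) :=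
  ⟨decider, decider_pr.to_comp, decider_correct⟩

/-- **Proposition 3.4**: the theory of `(ℝ; exp, ln, 0, 1, <)`, where `exp x = e^x` and
`ln x = 0` for non-positive `x`, admits elimination of quantifiers, and hence is decidable. -/
theorem expLang_qe_and_decidable :
    (∀ (α : Type) (φ : expLang.Formula α), ∃ ψ : expLang.Formula α,
      ψ.IsQF ∧ ∀ v : α → ℝ, φ.Realize v ↔ ψ.Realize v) ∧
    DecidableVia (expLang.completeTheory ℝ) := by
  exact ⟨qe_main, dec_main⟩

end Paper
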